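/- In the doubled frame setting, let d : U → ℝ be smooth and strictly positive on an open set U ⊆ ℝⁿ×ℝⁿ and satisfy the eikonal hypotheses, let p ∈ U, α ∈ (0,1), L > 0, μ > 0, and c₀ ≥ 0 with ⟨((D_𝔷²d)*)² · D_𝔷d, D_𝔷d⟩(p) ≤ c₀. Set M = L (D_𝔷²(d^α))*(p) (a 2n×2n symmetric matrix), ξ = L (Z₁(d^α)(p),…,Zₙ(d^α)(p)) ∈ ℝⁿ, and η = L (Zₙ₊₁(d^α)(p),…,Z₂ₙ(d^α)(p)) ∈ ℝⁿ. If X and Y are symmetric n×n real matrices such that the block-diagonal matrix diag(X, −Y) satisfies diag(X, −Y) ≤ M + μ⁻¹M² in the Loewner order, then ⟨Xξ, ξ⟩ − ⟨Yη, η⟩ ≤ 4α³(α−1) L³ d(p)^{3α−4} + (L⁴/μ)(c₀ α⁴ d(p)^{4α−4} + 8α⁴(α−1)² d(p)^{4α−6}). -/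

import Mathlib

open Matrix

noncomputable section

/-- Doubled frame on `ℝⁿ × ℝⁿ`: `Z (inl i) (x,y) = (Xᵢ(x), 0)` and
`Z (inr i) (x,y) = (0, Xᵢ(y))`. -/
def Zf {n : ℕ} (X : Fin n → (Fin n → ℝ) → (Fin n → ℝ)) :
    (Fin n ⊕ Fin n) → (Fin n → ℝ) × (Fin n → ℝ) → (Fin n → ℝ) × (Fin n → ℝ)
  | Sum.inl i, p => (X i p.1, 0)
  | Sum.inr i, p => (0, X i p.2)

/-- Frame gradient `D_𝔷 d` of `d` at `p`, as a vector in `ℝ²ⁿ`. -/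
def Dz {n : ℕ} (X : Fin n → (Fin n → ℝ) → (Fin n → ℝ))
    (d : (Fin n → ℝ) × (Fin n → ℝ) → ℝ) (p : (Fin n → ℝ) × (Fin n → ℝ)) :
    (Fin n ⊕ Fin n) → ℝ :=
  fun i => fderiv ℝ d p (Zf X i p)

/-- Frame second derivative `D²_𝔷 d` of `d` at `p`: the `2n × 2n` matrix with
`(i,j)`-entry `Zᵢ(Zⱼd)(p)`. -/
def Dz2 {n : ℕ} (X : Fin n → (Fin n → ℝ) → (Fin n → ℝ))
    (d : (Fin n → ℝ) × (Fin n → ℝ) → ℝ) (p : (Fin n → ℝ) × (Fin n → ℝ)) :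
    Matrix (Fin n ⊕ Fin n) (Fin n ⊕ Fin n) ℝ :=
  fun i j => fderiv ℝ (fun q => fderiv ℝ d q (Zf X j q)) p (Zf X i p)

/-- Symmetrized frame second derivative `(D²_𝔷 d)* = ½(D²_𝔷 d + (D²_𝔷 d)ᵗ)`. -/
def Dz2Sym {n : ℕ} (X : Fin n → (Fin n → ℝ) → (Fin n → ℝ))
    (d : (Fin n → ℝ) × (Fin n → ℝ) → ℝ) (p : (Fin n → ℝ) × (Fin n → ℝ)) :
    Matrix (Fin n ⊕ Fin n) (Fin n ⊕ Fin n) ℝ :=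
  (1 / 2 : ℝ) • (Dz2 X d p + (Dz2 X d p)ᵀ)

/-- The eikonal hypotheses: `Σᵢ₌₁ⁿ (Zᵢd)² = 1` and `Σᵢ₌ₙ₊₁²ⁿ (Zᵢd)² = 1` on `U`. -/
def EikonalHyp {n : ℕ} (X : Fin n → (Fin n → ℝ) → (Fin n → ℝ))
    (d : (Fin n → ℝ) × (Fin n → ℝ) → ℝ)
    (U : Set ((Fin n → ℝ) × (Fin n → ℝ))) : Prop :=
  ∀ p ∈ U, (∑ i : Fin n, (Dz X d p (Sum.inl i)) ^ 2 = 1) ∧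
    (∑ i : Fin n, (Dz X d p (Sum.inr i)) ^ 2 = 1)

theorem differentiable_Zf {n : ℕ} {X : Fin n → (Fin n → ℝ) → (Fin n → ℝ)}
    (hX : ∀ i, ContDiff ℝ (⊤ : ℕ∞) (X i)) (i : Fin n ⊕ Fin n) :
    Differentiable ℝ (Zf X i) := by
  have hX' : ∀ i, Differentiable ℝ (X i) := fun i => (hX i).differentiable (by simp)
  rcases i with i | i
  · exact ((hX' i).comp differentiable_fst).prodMk (differentiable_const 0)
  · exact (differentiable_const 0).prodMk ((hX' i).comp differentiable_snd)

theorem differentiableAt_Dz {n : ℕ} {X : Fin n → (Fin n → ℝ) → (Fin n → ℝ)}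
    (hX : ∀ i, ContDiff ℝ (⊤ : ℕ∞) (X i))
    {d : (Fin n → ℝ) × (Fin n → ℝ) → ℝ} {p : (Fin n → ℝ) × (Fin n → ℝ)}
    (hd : ContDiffAt ℝ (⊤ : ℕ∞) d p) (i : Fin n ⊕ Fin n) :
    DifferentiableAt ℝ (fun q => Dz X d q i) p := by
  have h : DifferentiableAt ℝ (fderiv ℝ d) p :=
    (hd.fderiv_right (m := 1) (by norm_cast)).differentiableAt (by simp)
  exact h.clm_apply (differentiable_Zf hX i p)

theorem Dz_rpow {n : ℕ} (X : Fin n → (Fin n → ℝ) → (Fin n → ℝ))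
    {d : (Fin n → ℝ) × (Fin n → ℝ) → ℝ} {p : (Fin n → ℝ) × (Fin n → ℝ)}
    (hd : DifferentiableAt ℝ d p) (hpos : 0 < d p) (α : ℝ) (i : Fin n ⊕ Fin n) :
    Dz X (fun q => d q ^ α) p i = α * d p ^ (α - 1) * Dz X d p i := by
  simp [Dz, (hd.hasFDerivAt.rpow_const (p := α) (Or.inl hpos.ne')).fderiv]

theorem Dz2_rpow {n : ℕ} {X : Fin n → (Fin n → ℝ) → (Fin n → ℝ)}
    (hX : ∀ i, ContDiff ℝ (⊤ : ℕ∞) (X i))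
    {U : Set ((Fin n → ℝ) × (Fin n → ℝ))} (hU : IsOpen U)
    {d : (Fin n → ℝ) × (Fin n → ℝ) → ℝ} (hd : ContDiffOn ℝ (⊤ : ℕ∞) d U)
    (hdpos : ∀ p ∈ U, 0 < d p)
    {p : (Fin n → ℝ) × (Fin n → ℝ)} (hp : p ∈ U) (α : ℝ) :
    Dz2 X (fun q => d q ^ α) p = (α * d p ^ (α - 1)) • Dz2 X d p
      + (α * (α - 1) * d p ^ (α - 2)) • vecMulVec (Dz X d p) (Dz X d p) := by
  have hdAt : ∀ q ∈ U, ContDiffAt ℝ (⊤ : ℕ∞) d q := fun q hq => hd.contDiffAt (hU.mem_nhds hq)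
  have hdiff : ∀ q ∈ U, DifferentiableAt ℝ d q := fun q hq =>
    (hdAt q hq).differentiableAt (by simp)
  ext i j
  have hev : (fun q => fderiv ℝ (fun q => d q ^ α) q (Zf X j q))
      =ᶠ[nhds p] fun q => α * d q ^ (α - 1) * Dz X d q j :=
    Filter.eventuallyEq_of_mem (hU.mem_nhds hp) fun q hq =>
      Dz_rpow X (hdiff q hq) (hdpos q hq) α j
  have h₁ := ((hdiff p hp).hasFDerivAt.rpow_const (p := α - 1)
    (Or.inl (hdpos p hp).ne')).const_mul α
  have h₂ := (differentiableAt_Dz hX (hdAt p hp) j).hasFDerivAt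
  have he : Dz2 X (fun q => d q ^ α) p i j
      = fderiv ℝ (fun q => α * d q ^ (α - 1) * Dz X d q j) p (Zf X i p) := by
    simp only [Dz2, hev.fderiv_eq]
  have h2 : Dz2 X d p i j = fderiv ℝ (fun q => Dz X d q j) p (Zf X i p) := rfl
  have h1 : Dz X d p i = fderiv ℝ d p (Zf X i p) := rfl
  rw [he, (h₁.fun_mul h₂).fderiv]
  simp only [Matrix.add_apply, Matrix.smul_apply, vecMulVec_apply, h2, h1,
    _root_.add_apply, _root_.smul_apply, smul_eq_mul]
  rw [show α - 1 - 1 = α - 2 by ring]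
  ring

theorem EikonalHyp.Dz_dotProduct_self {n : ℕ} {X : Fin n → (Fin n → ℝ) → (Fin n → ℝ)}
    {d : (Fin n → ℝ) × (Fin n → ℝ) → ℝ} {U : Set ((Fin n → ℝ) × (Fin n → ℝ))}
    (h : EikonalHyp X d U) {p : (Fin n → ℝ) × (Fin n → ℝ)} (hp : p ∈ U) :
    Dz X d p ⬝ᵥ Dz X d p = 2 := by
  obtain ⟨h₁, h₂⟩ := h p hp
  simp only [dotProduct, Fintype.sum_sum_type, ← pow_two, h₁, h₂]
  norm_num

theorem EikonalHyp.Dz2_mulVec_Dz {n : ℕ} {X : Fin n → (Fin n → ℝ) → (Fin n → ℝ)}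
    (hX : ∀ i, ContDiff ℝ (⊤ : ℕ∞) (X i))
    {U : Set ((Fin n → ℝ) × (Fin n → ℝ))} (hU : IsOpen U)
    {d : (Fin n → ℝ) × (Fin n → ℝ) → ℝ} (hd : ContDiffOn ℝ (⊤ : ℕ∞) d U)
    (h : EikonalHyp X d U) {p : (Fin n → ℝ) × (Fin n → ℝ)} (hp : p ∈ U) :
    (Dz2 X d p).mulVec (Dz X d p) = 0 := by
  ext i
  have hD := fun j => (differentiableAt_Dz hX (hd.contDiffAt (hU.mem_nhds hp)) j).hasFDerivAt
  have hsum := HasFDerivAt.fun_sum (u := Finset.univ) fun j _ => (hD j).mul (hD j)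
  have hev : (fun q => ∑ j, Dz X d q j * Dz X d q j) =ᶠ[nhds p] fun _ => (2 : ℝ) :=
    Filter.eventuallyEq_of_mem (hU.mem_nhds hp) fun q hq => h.Dz_dotProduct_self hq
  have hz := congrArg (fun T => T (Zf X i p)) (hsum.fderiv.symm.trans hev.fderiv_eq)
  have h2 : ∀ j, Dz2 X d p i j = fderiv ℝ (fun q => Dz X d q j) p (Zf X i p) := fun _ => rfl
  simp only [fderiv_fun_const, Pi.zero_apply, _root_.zero_apply,
    _root_.sum_apply, _root_.add_apply,
    _root_.smul_apply, smul_eq_mul, ← h2, ← two_mul, ← Finset.mul_sum] at hz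
  simpa [mulVec, dotProduct, mul_comm] using hz

theorem Dz2Sym_isSymm {n : ℕ} (X : Fin n → (Fin n → ℝ) → (Fin n → ℝ))
    (d : (Fin n → ℝ) × (Fin n → ℝ) → ℝ) (p : (Fin n → ℝ) × (Fin n → ℝ)) :
    (Dz2Sym X d p).IsSymm := by
  simp [Matrix.IsSymm, Dz2Sym, add_comm]

theorem Dz2Sym_rpow {n : ℕ} {X : Fin n → (Fin n → ℝ) → (Fin n → ℝ)}
    (hX : ∀ i, ContDiff ℝ (⊤ : ℕ∞) (X i))
    {U : Set ((Fin n → ℝ) × (Fin n → ℝ))} (hU : IsOpen U)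
    {d : (Fin n → ℝ) × (Fin n → ℝ) → ℝ} (hd : ContDiffOn ℝ (⊤ : ℕ∞) d U)
    (hdpos : ∀ p ∈ U, 0 < d p)
    {p : (Fin n → ℝ) × (Fin n → ℝ)} (hp : p ∈ U) (α : ℝ) :
    Dz2Sym X (fun q => d q ^ α) p = (α * d p ^ (α - 1)) • Dz2Sym X d p
      + (α * (α - 1) * d p ^ (α - 2)) • vecMulVec (Dz X d p) (Dz X d p) := by
  ext i j
  simp only [Dz2Sym, Dz2_rpow hX hU hd hdpos hp, Matrix.add_apply, Matrix.smul_apply,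
    Matrix.transpose_apply, vecMulVec_apply, smul_eq_mul]
  ring

theorem EikonalHyp.Dz2Sym_mulVec_Dz_dotProduct_Dz {n : ℕ}
    {X : Fin n → (Fin n → ℝ) → (Fin n → ℝ)}
    (hX : ∀ i, ContDiff ℝ (⊤ : ℕ∞) (X i))
    {U : Set ((Fin n → ℝ) × (Fin n → ℝ))} (hU : IsOpen U)
    {d : (Fin n → ℝ) × (Fin n → ℝ) → ℝ} (hd : ContDiffOn ℝ (⊤ : ℕ∞) d U)
    (h : EikonalHyp X d U) {p : (Fin n → ℝ) × (Fin n → ℝ)} (hp : p ∈ U) :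
    (Dz2Sym X d p).mulVec (Dz X d p) ⬝ᵥ Dz X d p = 0 := by
  have h0 := h.Dz2_mulVec_Dz hX hU hd hp
  rw [Dz2Sym, smul_mulVec, add_mulVec, h0, zero_add, mulVec_transpose, smul_dotProduct,
    ← dotProduct_mulVec, h0, dotProduct_zero, smul_zero]

theorem Matrix.IsSymm.mul_self_mulVec_dotProduct {m R : Type*} [Fintype m] [CommRing R]
    {S : Matrix m m R} (hS : S.IsSymm) (v : m → R) :
    (S * S).mulVec v ⬝ᵥ v = S.mulVec v ⬝ᵥ S.mulVec v := by
  rw [← mulVec_mulVec, dotProduct_comm, dotProduct_mulVec, ← mulVec_transpose, hS.eq]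

/-- In the doubled frame setting, let `d` be smooth and strictly positive on
an open `U ⊆ ℝⁿ×ℝⁿ` satisfying the eikonal hypotheses, `p ∈ U`, `α ∈ (0,1)`, `L > 0`,
`μ > 0`, `c₀ ≥ 0` with `⟨((D²_𝔷d)*)² · D_𝔷d, D_𝔷d⟩(p) ≤ c₀`.  Set
`M = L (D²_𝔷(d^α))*(p)`, `ξ = L (Z₁(d^α)(p),…,Zₙ(d^α)(p))`,
`η = L (Zₙ₊₁(d^α)(p),…,Z₂ₙ(d^α)(p))`.  If `X`, `Y` are symmetric `n×n` matrices with
`diag(X, −Y) ≤ M + μ⁻¹M²` in the Loewner order, then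
`⟨Xξ, ξ⟩ − ⟨Yη, η⟩ ≤ 4α³(α−1) L³ d(p)^(3α−4) + (L⁴/μ)(c₀ α⁴ d(p)^(4α−4) + 8α⁴(α−1)² d(p)^(4α−6))`. -/
theorem stmt17 {n : ℕ} (X : Fin n → (Fin n → ℝ) → (Fin n → ℝ))
    (hX : ∀ i, ContDiff ℝ (⊤ : ℕ∞) (X i))
    (U : Set ((Fin n → ℝ) × (Fin n → ℝ))) (hU : IsOpen U)
    (d : (Fin n → ℝ) × (Fin n → ℝ) → ℝ) (hd : ContDiffOn ℝ (⊤ : ℕ∞) d U)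
    (hdpos : ∀ p ∈ U, 0 < d p)
    (heik : EikonalHyp X d U)
    (p : (Fin n → ℝ) × (Fin n → ℝ)) (hp : p ∈ U)
    (α L μ c₀ : ℝ) (hα : α ∈ Set.Ioo (0 : ℝ) 1) (hL : 0 < L) (hμ : 0 < μ) (hc₀ : 0 ≤ c₀)
    (hQ : (Dz2Sym X d p * Dz2Sym X d p).mulVec (Dz X d p) ⬝ᵥ Dz X d p ≤ c₀)
    (M : Matrix (Fin n ⊕ Fin n) (Fin n ⊕ Fin n) ℝ)
    (hM : M = L • Dz2Sym X (fun q => d q ^ α) p)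
    (ξ η : Fin n → ℝ)
    (hξ : ξ = fun i => L * Dz X (fun q => d q ^ α) p (Sum.inl i))
    (hη : η = fun i => L * Dz X (fun q => d q ^ α) p (Sum.inr i))
    (Xm Ym : Matrix (Fin n) (Fin n) ℝ) (hXm : Xm.IsSymm) (hYm : Ym.IsSymm)
    (hLoewner : ∀ v : Fin n ⊕ Fin n → ℝ,
      (Matrix.fromBlocks Xm 0 0 (-Ym)).mulVec v ⬝ᵥ v ≤ (M + μ⁻¹ • (M * M)).mulVec v ⬝ᵥ v) :
    Xm.mulVec ξ ⬝ᵥ ξ - Ym.mulVec η ⬝ᵥ η ≤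
      4 * α ^ 3 * (α - 1) * L ^ 3 * d p ^ (3 * α - 4)
        + (L ^ 4 / μ) * (c₀ * α ^ 4 * d p ^ (4 * α - 4)
            + 8 * α ^ 4 * (α - 1) ^ 2 * d p ^ (4 * α - 6)) := by
  obtain ⟨hα0, hα1⟩ := hα
  have hpos := hdpos p hp
  have hdiff : DifferentiableAt ℝ d p :=
    (hd.contDiffAt (hU.mem_nhds hp)).differentiableAt (by simp)
  have hgg := heik.Dz_dotProduct_self hp
  have hSg := heik.Dz2Sym_mulVec_Dz_dotProduct_Dz hX hU hd hp
  rw [(Dz2Sym_isSymm X d p).mul_self_mulVec_dotProduct] at hQ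
  rw [Dz2Sym_rpow hX hU hd hdpos hp] at hM
  have hMsymm : M.IsSymm := by
    subst hM
    refine Matrix.IsSymm.smul (Matrix.IsSymm.add ((Dz2Sym_isSymm X d p).smul _) ?_) L
    exact Matrix.IsSymm.smul (transpose_vecMulVec _ _) _
  have hv : Sum.elim ξ η = (L * (α * d p ^ (α - 1))) • Dz X d p := by
    ext (i | i) <;> simp [hξ, hη, Dz_rpow X hdiff hpos, mul_assoc]
  have hkey := hLoewner (Sum.elim ξ η)
  have hl : (Matrix.fromBlocks Xm 0 0 (-Ym)).mulVec (Sum.elim ξ η) ⬝ᵥ Sum.elim ξ η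
      = Xm.mulVec ξ ⬝ᵥ ξ - Ym.mulVec η ⬝ᵥ η := by
    simp [fromBlocks_mulVec, neg_mulVec, sub_eq_add_neg]
  rw [hl, hv, add_mulVec, add_dotProduct, smul_mulVec, smul_dotProduct,
    hMsymm.mul_self_mulVec_dotProduct, mulVec_smul] at hkey
  have hp3 : d p ^ (3 * α - 4) = (d p ^ (α - 1)) ^ 2 * d p ^ (α - 2) := by
    rw [← Real.rpow_mul_natCast hpos.le, ← Real.rpow_add hpos]
    congr 1; push_cast; ring
  have hp4 : d p ^ (4 * α - 4) = (d p ^ (α - 1)) ^ 4 := by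
    rw [← Real.rpow_mul_natCast hpos.le]
    congr 1; push_cast; ring
  have hp6 : d p ^ (4 * α - 6) = (d p ^ (α - 1)) ^ 2 * (d p ^ (α - 2)) ^ 2 := by
    rw [← Real.rpow_mul_natCast hpos.le, ← Real.rpow_mul_natCast hpos.le, ← Real.rpow_add hpos]
    congr 1; push_cast; ring
  rw [hp3, hp4, hp6]
  generalize d p ^ (α - 1) = s at *
  generalize d p ^ (α - 2) = t at *
  have hMg : M.mulVec (Dz X d p) = (L * (α * s)) • (Dz2Sym X d p).mulVec (Dz X d p)
      + (L * (α * (α - 1) * t) * 2) • Dz X d p := by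
    rw [hM, smul_mulVec, add_mulVec, smul_mulVec, smul_mulVec, vecMulVec_mulVec, hgg]
    ext i
    simp
    ring
  rw [hMg] at hkey
  have hgS : Dz X d p ⬝ᵥ (Dz2Sym X d p).mulVec (Dz X d p) = 0 := by
    rw [dotProduct_comm, hSg]
  simp only [smul_dotProduct, dotProduct_smul, add_dotProduct, dotProduct_add, hgg, hSg, hgS,
    smul_eq_mul] at hkey
  have hbound := mul_le_mul_of_nonneg_left hQ
    (show 0 ≤ L ^ 4 / μ * α ^ 4 * s ^ 4 by positivity)
  refine hkey.trans ?_
  rw [div_eq_mul_inv] at *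
  linarith
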